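/- Let t ≥ 2 be an even integer and let G be a 2-connected 2t-regular finite simple graph. Let 𝒪 be a set of pairwise edge-disjoint odd cycles of G. Then there exists a t-factor F of G such that, for every O ∈ 𝒪, both E(O) ∩ E(F) ≠ ∅ and E(O) ∩ (E(G) \ E(F)) ≠ ∅. -/

import Mathlib

open SimpleGraph

namespace PaperFormalization

variable {V : Type*}

/-- The degree of a vertex in a subgraph. -/
noncomputable def sdeg {G : SimpleGraph V} (H : G.Subgraph) (v : V) : ℕ :=
  (H.neighborSet v).ncard

/-- `H` is a `t`-factor of `G`: a spanning subgraph in which every vertex has degree `t`. -/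
def IsTFactor {G : SimpleGraph V} (H : G.Subgraph) (t : ℕ) : Prop :=
  H.IsSpanning ∧ ∀ v : V, sdeg H v = t

/-- A cycle of `G`: a connected 2-regular subgraph. -/
def IsCycleSG {G : SimpleGraph V} (C : G.Subgraph) : Prop :=
  C.Connected ∧ ∀ v ∈ C.verts, sdeg C v = 2

/-- An odd cycle: a cycle with an odd number of edges. -/
def IsOddCycleSG {G : SimpleGraph V} (C : G.Subgraph) : Prop :=
  IsCycleSG C ∧ Odd C.edgeSet.ncard

/-- A family of subgraphs is pairwise edge-disjoint. -/
def PairwiseEdgeDisjoint {G : SimpleGraph V} (𝒪 : Set G.Subgraph) : Prop :=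
  𝒪.Pairwise fun O₁ O₂ => Disjoint O₁.edgeSet O₂.edgeSet

/-- A family of subgraphs is pairwise vertex-disjoint. -/
def PairwiseVertexDisjoint {G : SimpleGraph V} (𝒪 : Set G.Subgraph) : Prop :=
  𝒪.Pairwise fun O₁ O₂ => Disjoint O₁.verts O₂.verts

/-- `G` is `r`-regular. -/
def IsRegular (G : SimpleGraph V) (r : ℕ) : Prop :=
  ∀ v : V, (G.neighborSet v).ncard = r

/-- `G` is 2-connected: connected, at least 3 vertices, and no cut vertex. -/
def TwoConnected [Fintype V] (G : SimpleGraph V) : Prop :=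
  G.Connected ∧ 3 ≤ Fintype.card V ∧ ∀ v : V, (G.induce {u | u ≠ v}).Connected

/-- `G` is `r`-connected: more than `r` vertices and deleting fewer than `r`
vertices leaves it connected. -/
def KConnected [Fintype V] (r : ℕ) (G : SimpleGraph V) : Prop :=
  r < Fintype.card V ∧ ∀ S : Set V, S.ncard < r → (G.induce Sᶜ).Connected

/-- A set of edges is a matching: pairwise non-adjacent edges. -/
def IsMatchingSet (M : Set (Sym2 V)) : Prop :=
  M.Pairwise fun e f => ∀ v : V, v ∈ e → v ∉ f

section Involutions

variable {D : Type*}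

lemma even_card_of_involution (s : Finset D) (p : D → D)
    (hp : ∀ d ∈ s, p (p d) = d) (hne : ∀ d ∈ s, p d ≠ d) (hs : ∀ d ∈ s, p d ∈ s) :
    Even s.card := by
  have h : ∑ d ∈ s, (1 : ZMod 2) = 0 :=
    Finset.sum_involution (fun d _ => p d) (fun _ _ => by decide) (fun d hd _ => hne d hd)
      (fun d hd => hs d hd) (fun d hd => hp d hd)
  rw [Finset.sum_const, nsmul_eq_mul, mul_one] at h
  exact (ZMod.natCast_eq_zero_iff_even).1 h

/-- A fixed-point-free involution has a set of representatives of its orbits. -/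
lemma exists_transversal [Finite D] (p : D → D) (hp : p.Involutive) (hne : ∀ d, p d ≠ d) :
    ∃ H : Set D, ∀ d, p d ∈ H ↔ d ∉ H := by
  obtain ⟨n, ⟨e⟩⟩ := Finite.exists_equiv_fin D
  refine ⟨{d | e d < e (p d)}, fun d => ?_⟩
  have : e d ≠ e (p d) := fun h => hne d (e.injective h).symm
  simp only [Set.mem_ofPred_eq, hp d, not_lt]
  exact ⟨le_of_lt, fun h => lt_of_le_of_ne h this.symm⟩

open Classical in
lemma card_eq_two_mul_transversal (s : Finset D) (p : D → D) (hp : p.Involutive)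
    (hs : ∀ d ∈ s, p d ∈ s) (H : Set D) (hH : ∀ d, p d ∈ H ↔ d ∉ H) :
    s.card = 2 * (s.filter (· ∈ H)).card := by
  rw [← Finset.card_filter_add_card_filter_not (s := s) (· ∈ H), two_mul]
  congr 1
  refine Finset.card_bij' (fun d _ => p d) (fun d _ => p d) ?_ ?_ ?_ ?_
  · intro d hd
    simp only [Finset.mem_filter] at hd ⊢
    exact ⟨hs d hd.1, (hH d).2 hd.2⟩
  · intro d hd
    simp only [Finset.mem_filter] at hd ⊢
    exact ⟨hs d hd.1, fun h => (hH d).1 h hd.2⟩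
  · intro d _; exact hp d
  · intro d _; exact hp d

lemma exists_involution_of_even_card {X : Type*} [Finite X] (h : Even (Nat.card X)) :
    ∃ q : X → X, q.Involutive ∧ ∀ x, q x ≠ x := by
  obtain ⟨k, hk⟩ := h
  have e : X ≃ Fin k ⊕ Fin k :=
    (Finite.equivFinOfCardEq hk).trans finSumFinEquiv.symm
  refine ⟨fun x => e.symm (e x).swap, fun x => by simp, fun x hx => ?_⟩
  have h2 : (e x).swap = e x := by
    have := congrArg e hx
    simpa using this
  rcases h3 : e x with y | y <;> simp [h3] at h2

/-- If all fibres of `f` are even, some fixed-point-free involution preserves `f`. -/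
lemma exists_involution_of_even_fibers {K : Type*} [Finite D] (f : D → K)
    (h : ∀ k, Even (Nat.card {d // f d = k})) :
    ∃ p : D → D, p.Involutive ∧ (∀ d, p d ≠ d) ∧ ∀ d, f (p d) = f d := by
  choose q hq hne using fun k => exists_involution_of_even_card (h k)
  let e := Equiv.sigmaFiberEquiv f
  let P : (Σ k, {d // f d = k}) → (Σ k, {d // f d = k}) := fun x => ⟨x.1, q x.1 x.2⟩
  have hf : ∀ x, f (e x) = x.1 := fun x => x.2.2
  refine ⟨fun d => e (P (e.symm d)), fun d => ?_, fun d hd => ?_, fun d => ?_⟩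
  · have : ∀ x, P (P x) = x := fun x => by
      simp only [P]; rw [hq]
    simp [this]
  · have h1 : P (e.symm d) = e.symm d := by
      have := congrArg e.symm hd
      simpa using this
    generalize e.symm d = x at h1
    obtain ⟨k, y⟩ := x
    simp only [P, Sigma.mk.injEq, heq_eq_eq, true_and] at h1
    exact hne k y h1
  · have h1 := hf (P (e.symm d))
    have h2 := hf (e.symm d)
    rw [e.apply_symm_apply] at h2
    rw [h1, h2]

open Classical in
/-- If every set of darts closed under both involutions has size divisible by four, then the
darts have a colouring fixed by the first involution and reversed by the second one. -/
lemma exists_alternating_coloring [Fintype D] (r p : D → D)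
    (hr : r.Involutive) (hp : p.Involutive) (hpne : ∀ d, p d ≠ d)
    (h4 : ∀ S : Finset D, (∀ d ∈ S, r d ∈ S) → (∀ d ∈ S, p d ∈ S) → 4 ∣ S.card) :
    ∃ c : D → ZMod 2, (∀ d, c (r d) = c d) ∧ ∀ d, c (p d) = c d + 1 := by
  let L : (D → ZMod 2) →ₗ[ZMod 2] (D ⊕ D → ZMod 2) :=
    { toFun := fun c => Sum.elim (fun d => c (r d) + c d) (fun d => c (p d) + c d)
      map_add' := by
        intro a b; ext (d | d) <;> simp <;> ring
      map_smul' := by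
        intro a b; ext (d | d) <;> simp <;> ring }
  let b : D ⊕ D → ZMod 2 := Sum.elim (fun _ => 0) (fun _ => 1)
  by_cases hb : b ∈ LinearMap.range L
  · obtain ⟨c, hc⟩ := hb
    refine ⟨c, fun d => ?_, fun d => ?_⟩
    · have := congrFun hc (Sum.inl d)
      simp only [L, b, LinearMap.coe_mk, AddHom.coe_mk, Sum.elim_inl] at this
      exact (CharTwo.add_eq_zero).1 this
    · have := congrFun hc (Sum.inr d)
      simp only [L, b, LinearMap.coe_mk, AddHom.coe_mk, Sum.elim_inr] at this
      rw [← this, add_comm (c (p d)), ← add_assoc, CharTwo.add_self_eq_zero, zero_add]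
  exfalso
  obtain ⟨φ, hφ, hker⟩ := Submodule.exists_le_ker_of_notMem hb
  let y : D → ZMod 2 := fun d => φ (Pi.single (Sum.inl d) 1)
  let z : D → ZMod 2 := fun d => φ (Pi.single (Sum.inr d) 1)
  have hφsum : ∀ v, φ v = ∑ d, v (Sum.inl d) * y d + ∑ d, v (Sum.inr d) * z d := by
    intro v
    have := LinearMap.pi_apply_eq_sum_univ φ v
    rw [Fintype.sum_sum_type] at this
    rw [this]
    simp only [smul_eq_mul, y, z]
    have hs : ∀ x : D ⊕ D, (fun j => if x = j then (1 : ZMod 2) else 0) = Pi.single x 1 := by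
      intro x; ext j; simp [Pi.single_apply, eq_comm]
    simp only [hs]
  have hzero : ∀ c, φ (L c) = 0 := fun c => hker ⟨c, rfl⟩
  have key : ∀ d, y (r d) + y d + (z (p d) + z d) = 0 := by
    intro d
    have h1 := hzero (Pi.single d 1)
    rw [hφsum] at h1
    simp only [L, LinearMap.coe_mk, AddHom.coe_mk, Sum.elim_inl, Sum.elim_inr, add_mul,
      Finset.sum_add_distrib] at h1
    have hA : ∀ (q : D → D), q.Involutive → ∀ w : D → ZMod 2,
        ∑ x, (Pi.single d 1 : D → ZMod 2) (q x) * w x = w (q d) := by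
      intro q hq w
      rw [Finset.sum_eq_single (q d)]
      · simp [hq d]
      · intro x _ hx
        rw [Pi.single_eq_of_ne, zero_mul]
        intro h; exact hx (by rw [← h, hq])
      · simp
    have hB := hA id (fun _ => rfl)
    simp only [id] at hB
    rw [hA r hr, hA p hp, hB, hB] at h1
    exact h1
  have key' : ∀ d, y (r d) + y d = z (p d) + z d := fun d => CharTwo.add_eq_zero.1 (key d)
  obtain ⟨H, hH⟩ := exists_transversal p hp hpne
  let S : Finset D := Finset.univ.filter (fun d => z (p d) + z d = 1)
  have hSp : ∀ d ∈ S, p d ∈ S := by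
    intro d hd
    simp only [S, Finset.mem_filter, Finset.mem_univ, true_and, hp d] at hd ⊢
    rw [add_comm, hd]
  have hSr : ∀ d ∈ S, r d ∈ S := by
    intro d hd
    simp only [S, Finset.mem_filter, Finset.mem_univ, true_and, ← key', hr d] at hd ⊢
    rw [add_comm, hd]
  have hcard := h4 S hSr hSp
  rw [card_eq_two_mul_transversal S p hp hSp H hH] at hcard
  apply hφ
  rw [hφsum]
  simp only [b, Sum.elim_inl, Sum.elim_inr, zero_mul, Finset.sum_const_zero, zero_add, one_mul]
  have hsplit : ∑ d, z d = ∑ d with d ∈ H, (z (p d) + z d) := by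
    rw [Finset.sum_add_distrib, ← Finset.sum_filter_add_sum_filter_not Finset.univ (· ∈ H),
      add_comm]
    congr 1
    refine Finset.sum_bij' (fun d _ => p d) (fun d _ => p d) ?_ ?_ ?_ ?_ ?_
    · intro d hd; simp only [Finset.mem_filter, Finset.mem_univ, true_and] at hd ⊢
      exact (hH d).2 hd
    · intro d hd; simp only [Finset.mem_filter, Finset.mem_univ, true_and] at hd ⊢
      exact fun h => (hH d).1 h hd
    · intro d _; exact hp d
    · intro d _; exact hp d
    · intro d _; rw [hp d]
  have h01 : ∀ x : ZMod 2, x = if x = 1 then 1 else 0 := by decide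
  rw [hsplit, Finset.sum_congr rfl (fun d _ => h01 (z (p d) + z d)), Finset.sum_boole,
    Finset.filter_filter]
  have hfil : Finset.univ.filter (fun d => d ∈ H ∧ z (p d) + z d = 1) = S.filter (· ∈ H) := by
    ext d; simp [S, and_comm]
  rw [hfil, ZMod.natCast_eq_zero_iff]
  omega

end Involutions

section Uncrossing

variable {D : Type*} [Fintype D]

/-- Every set of darts closed under `r`, `p` and the links in `Q` has size divisible by four. -/
def DivisibleByFour (r p : D → D) (Q : List (D × D)) : Prop :=
  ∀ S : Finset D, (∀ d ∈ S, r d ∈ S) → (∀ d ∈ S, p d ∈ S) →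
    (∀ q ∈ Q, q.1 ∈ S ↔ q.2 ∈ S) → 4 ∣ S.card

open Classical in
lemma exists_bad_mem {r p p' : D → D} {Q : List (D × D)} {a b : D}
    (hr : r.Involutive) (hp' : p'.Involutive)
    (h : DivisibleByFour r p ((a, b) :: Q)) (h' : ¬ DivisibleByFour r p' Q)
    (hoff : ∀ d, d ≠ a → d ≠ p a → d ≠ b → d ≠ p b → p d = p' d)
    (hp : p.Involutive) :
    ∃ S : Finset D, a ∈ S ∧ (∀ d ∈ S, r d ∈ S) ∧ (∀ d ∈ S, p' d ∈ S) ∧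
      ¬ (b ∈ S ∧ p a ∈ S ∧ p b ∈ S) := by
  unfold DivisibleByFour at h'
  push Not at h'
  obtain ⟨S, hSr, hSp, hSQ, hS⟩ := h'
  have huniv : 4 ∣ (Finset.univ : Finset D).card := h _ (by simp) (by simp) (by simp)
  have main : ∀ S : Finset D, a ∈ S → (∀ d ∈ S, r d ∈ S) → (∀ d ∈ S, p' d ∈ S) →
      (∀ q ∈ Q, q.1 ∈ S ↔ q.2 ∈ S) → ¬ 4 ∣ S.card → ¬ (b ∈ S ∧ p a ∈ S ∧ p b ∈ S) := by
    rintro S ha hSr hSp hSQ hS ⟨hb, hpa, hpb⟩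
    refine hS (h S hSr (fun d hd => ?_) ?_)
    · by_cases h1 : d = a
      · rwa [h1]
      by_cases h2 : d = p a
      · rwa [h2, hp]
      by_cases h3 : d = b
      · rwa [h3]
      by_cases h4 : d = p b
      · rwa [h4, hp]
      rw [hoff d h1 h2 h3 h4]
      exact hSp d hd
    · intro q hq
      rcases List.mem_cons.1 hq with rfl | hq
      · exact iff_of_true ha hb
      · exact hSQ q hq
  by_cases ha : a ∈ S
  · exact ⟨S, ha, hSr, hSp, main S ha hSr hSp hSQ hS⟩
  · have hcr : ∀ d ∈ Sᶜ, r d ∈ Sᶜ := fun d hd => by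
      rw [Finset.mem_compl] at hd ⊢
      exact fun h => hd (by simpa [hr d] using hSr _ h)
    have hcp : ∀ d ∈ Sᶜ, p' d ∈ Sᶜ := fun d hd => by
      rw [Finset.mem_compl] at hd ⊢
      exact fun h => hd (by simpa [hp' d] using hSp _ h)
    have ha' : a ∈ Sᶜ := Finset.mem_compl.2 ha
    refine ⟨Sᶜ, ha', hcr, hcp, main Sᶜ ha' hcr hcp (fun q hq => ?_) ?_⟩
    · simp only [Finset.mem_compl, hSQ q hq]
    · have := Finset.card_add_card_compl S
      rw [Finset.card_univ] at huniv
      omega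

open Classical in
/-- Removing one link from a divisible system: one of the two ways of re-pairing works. -/
lemma DivisibleByFour.exists_swap {r p : D → D} {Q : List (D × D)} {a b : D}
    (hr : r.Involutive) (hrne : ∀ d, r d ≠ d) (hp : p.Involutive) (hpne : ∀ d, p d ≠ d)
    (h : DivisibleByFour r p ((a, b) :: Q)) :
    ∃ x y : D, (x = a ∨ x = p a) ∧ (y = b ∨ y = a) ∧
      DivisibleByFour r (fun d => Equiv.swap x y (p (Equiv.swap x y d))) Q := by
  by_cases htriv : b = a ∨ b = p a
  · refine ⟨a, a, Or.inl rfl, Or.inr rfl, fun S hSr hSp hSQ => h S hSr ?_ ?_⟩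
    · simpa using hSp
    · have hSp' : ∀ d ∈ S, p d ∈ S := by simpa using hSp
      intro q hq
      rcases List.mem_cons.1 hq with rfl | hq
      · rcases htriv with h | h
        · simp [h]
        · simp only [h]
          exact ⟨hSp' _, fun h => by simpa [hp a] using hSp' _ h⟩
      · exact hSQ q hq
  push Not at htriv
  obtain ⟨hba, hbpa⟩ := htriv
  have hpapb : p a ≠ p b := fun h => hba (hp.injective h).symm
  have hapb : a ≠ p b := fun h => hbpa (by rw [h, hp])
  by_contra hcon
  push Not at hcon
  have inv : ∀ s : Equiv.Perm D, (∀ d, s (s d) = d) →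
      Function.Involutive (fun d => s (p (s d))) := fun s hs d => by
    simp only [hs, hp (s d)]
  obtain ⟨S₁, ha₁, hr₁, hp₁, hn₁⟩ := exists_bad_mem hr (inv _ (fun d => by simp)) h
    (hcon (p a) b (Or.inr rfl) (Or.inl rfl)) (fun d h1 h2 h3 h4 => by
      have : p d ≠ p a := fun h => h1 (hp.injective h)
      have : p d ≠ b := fun h => h4 (by rw [← h, hp])
      rw [Equiv.swap_apply_of_ne_of_ne h2 h3, Equiv.swap_apply_of_ne_of_ne] <;> assumption) hp
  obtain ⟨S₂, ha₂, hr₂, hp₂, hn₂⟩ := exists_bad_mem hr (inv _ (fun d => by simp)) h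
    (hcon a b (Or.inl rfl) (Or.inl rfl)) (fun d h1 h2 h3 h4 => by
      have : p d ≠ a := fun h => h2 (by rw [← h, hp])
      have : p d ≠ b := fun h => h4 (by rw [← h, hp])
      rw [Equiv.swap_apply_of_ne_of_ne h1 h3, Equiv.swap_apply_of_ne_of_ne] <;> assumption) hp
  have e1 : Equiv.swap (p a) b (p (Equiv.swap (p a) b a)) = b := by
    rw [Equiv.swap_apply_of_ne_of_ne (hpne a).symm hba.symm, Equiv.swap_apply_left]
  have e2 : Equiv.swap (p a) b (p (Equiv.swap (p a) b (p a))) = p b := by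
    rw [Equiv.swap_apply_left, Equiv.swap_apply_of_ne_of_ne hpapb.symm (hpne b)]
  have e2' : Equiv.swap (p a) b (p (Equiv.swap (p a) b (p b))) = p a := by
    rw [Equiv.swap_apply_of_ne_of_ne hpapb.symm (hpne b), hp, Equiv.swap_apply_right]
  have e3 : Equiv.swap a b (p (Equiv.swap a b a)) = p b := by
    rw [Equiv.swap_apply_left, Equiv.swap_apply_of_ne_of_ne hapb.symm (hpne b)]
  have e4 : Equiv.swap a b (p (Equiv.swap a b b)) = p a := by
    rw [Equiv.swap_apply_right, Equiv.swap_apply_of_ne_of_ne (hpne a) hbpa.symm]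
  have e4' : Equiv.swap a b (p (Equiv.swap a b (p a))) = b := by
    rw [Equiv.swap_apply_of_ne_of_ne (hpne a) hbpa.symm, hp, Equiv.swap_apply_left]
  have hb₁ : b ∈ S₁ := e1 ▸ hp₁ a ha₁
  have hpb₂ : p b ∈ S₂ := e3 ▸ hp₂ a ha₂
  have hpa₁ : p a ∉ S₁ := fun h => hn₁ ⟨hb₁, h, e2 ▸ hp₁ _ h⟩
  have hpb₁ : p b ∉ S₁ := fun h => hpa₁ (e2' ▸ hp₁ _ h)
  have hb₂ : b ∉ S₂ := fun h => hn₂ ⟨h, e4 ▸ hp₂ _ h, hpb₂⟩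
  have hX : Even (S₁ ∩ S₂).card := by
    refine even_card_of_involution _ r (fun d _ => hr d) (fun d _ => hrne d) (fun d hd => ?_)
    rw [Finset.mem_inter] at hd ⊢
    exact ⟨hr₁ d hd.1, hr₂ d hd.2⟩
  have haX : a ∈ S₁ ∩ S₂ := Finset.mem_inter.2 ⟨ha₁, ha₂⟩
  have hY : Even ((S₁ ∩ S₂).erase a).card := by
    refine even_card_of_involution _ p (fun d _ => hp d) (fun d _ => hpne d) (fun d hd => ?_)
    rw [Finset.mem_erase, Finset.mem_inter] at hd ⊢
    obtain ⟨hda, hd1, hd2⟩ := hd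
    have h2 : d ≠ p a := fun h => hpa₁ (h ▸ hd1)
    have h3 : d ≠ b := fun h => hb₂ (h ▸ hd2)
    have h4 : d ≠ p b := fun h => hpb₁ (h ▸ hd1)
    have h5 : p d ≠ a := fun h => h2 (by rw [← h, hp])
    have h6 : p d ≠ p a := fun h => hda (hp.injective h)
    have h7 : p d ≠ b := fun h => h4 (by rw [← h, hp])
    have i1 := hp₁ d hd1
    have i2 := hp₂ d hd2
    simp only [Equiv.swap_apply_of_ne_of_ne h2 h3, Equiv.swap_apply_of_ne_of_ne h6 h7] at i1
    simp only [Equiv.swap_apply_of_ne_of_ne hda h3, Equiv.swap_apply_of_ne_of_ne h5 h7] at i2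
    exact ⟨h5, i1, i2⟩
  have := Finset.card_erase_add_one haX
  rw [← this, Nat.even_add_one] at hX
  exact hX hY

open Classical in
/-- All links can be removed by re-pairing inside the fibres of `β`, without touching anything
outside `T`. -/
lemma DivisibleByFour.exists_repairing {V : Type*} {r : D → D} (hr : r.Involutive)
    (hrne : ∀ d, r d ≠ d) (β : D → V) (T : Set D) (Q : List (D × D)) :
    ∀ p : D → D, p.Involutive → (∀ d, p d ≠ d) → (∀ d, β (p d) = β d) → (∀ d ∈ T, p d ∈ T) →
      (∀ q ∈ Q, β q.1 = β q.2 ∧ q.1 ∈ T ∧ q.2 ∈ T) → DivisibleByFour r p Q →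
      ∃ p' : D → D, p'.Involutive ∧ (∀ d, p' d ≠ d) ∧ (∀ d, β (p' d) = β d) ∧
        (∀ d, d ∉ T → p' d = p d) ∧ DivisibleByFour r p' [] := by
  induction Q with
  | nil => exact fun p h1 h2 h3 _ _ h6 => ⟨p, h1, h2, h3, fun _ _ => rfl, h6⟩
  | cons q Q ih =>
    obtain ⟨a, b⟩ := q
    intro p hp hpne hβ hT hQ h
    obtain ⟨x, y, hx, hy, hgood⟩ := h.exists_swap hr hrne hp hpne
    obtain ⟨hab, haT, hbT⟩ := hQ (a, b) (by simp)
    simp only at hab haT hbT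
    have hxT : x ∈ T := by rcases hx with rfl | rfl; exacts [haT, hT _ haT]
    have hyT : y ∈ T := by rcases hy with rfl | rfl <;> assumption
    have hxβ : β x = β a := by rcases hx with rfl | rfl; exacts [rfl, hβ _]
    have hyβ : β y = β a := by rcases hy with rfl | rfl; exacts [hab.symm, rfl]
    have hsβ : ∀ d, β (Equiv.swap x y d) = β d := fun d => by
      rw [Equiv.swap_apply_def]; split_ifs with h1 h2
      · rw [h1, hxβ, hyβ]
      · rw [h2, hxβ, hyβ]
      · rfl
    have hsT : ∀ d ∈ T, Equiv.swap x y d ∈ T := fun d hd => by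
      rw [Equiv.swap_apply_def]; split_ifs <;> assumption
    have hsT' : ∀ d, d ∉ T → Equiv.swap x y d = d := fun d hd =>
      Equiv.swap_apply_of_ne_of_ne (fun h => hd (h ▸ hxT)) (fun h => hd (h ▸ hyT))
    obtain ⟨p', h1, h2, h3, h4, h5⟩ := ih (fun d => Equiv.swap x y (p (Equiv.swap x y d)))
      (fun d => by simp [hp (Equiv.swap x y d)])
      (fun d hd => hpne (Equiv.swap x y d) (by
        have := congrArg (Equiv.swap x y) hd
        simpa using this))
      (fun d => by simp only [hsβ, hβ]) (fun d hd => hsT _ (hT _ (hsT _ hd)))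
      (fun q hq => hQ q (List.mem_cons_of_mem _ hq)) hgood
    refine ⟨p', h1, h2, h3, fun d hd => ?_, h5⟩
    have hpd : p d ∉ T := fun h => hd (by simpa [hp d] using hT _ h)
    rw [h4 d hd, hsT' d hd, hsT' _ hpd]

end Uncrossing

section Tutte

variable {W : Type*}

/-- `C` is the vertex set of an odd component of `Γ - U`. -/
structure IsOddComponent (Γ : SimpleGraph W) (U C : Finset W) : Prop where
  odd : Odd C.card
  disj : ∀ x ∈ C, x ∉ U
  closed : ∀ x ∈ C, ∀ y, Γ.Adj x y → y ∉ U → y ∈ C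
  minimal : ∀ X ⊆ C, X.Nonempty → (∀ x ∈ X, ∀ y, Γ.Adj x y → y ∉ U → y ∈ X) → C ⊆ X

open Classical in
lemma IsOddComponent.eq_of_mem {Γ : SimpleGraph W} {U C C' : Finset W} {x : W}
    (h : IsOddComponent Γ U C) (h' : IsOddComponent Γ U C') (hx : x ∈ C) (hx' : x ∈ C') :
    C = C' := by
  have key : ∀ y ∈ C ∩ C', ∀ z, Γ.Adj y z → z ∉ U → z ∈ C ∩ C' := fun y hy z hyz hz => by
    rw [Finset.mem_inter] at hy ⊢
    exact ⟨h.closed y hy.1 z hyz hz, h'.closed y hy.2 z hyz hz⟩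
  have hne : (C ∩ C').Nonempty := ⟨x, Finset.mem_inter.2 ⟨hx, hx'⟩⟩
  exact Finset.Subset.antisymm
    ((h.minimal _ Finset.inter_subset_left hne key).trans Finset.inter_subset_right)
    ((h'.minimal _ Finset.inter_subset_right hne key).trans Finset.inter_subset_left)

variable [Fintype W]

open Classical in
/-- The vertex sets of the odd components of `Γ - U`. -/
noncomputable def oddComponentSets (Γ : SimpleGraph W) (U : Finset W) : Finset (Finset W) :=
  Finset.univ.filter (IsOddComponent Γ U)

lemma mem_oddComponentSets {Γ : SimpleGraph W} {U C : Finset W} :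
    C ∈ oddComponentSets Γ U ↔ IsOddComponent Γ U C := by
  simp [oddComponentSets]

open Classical in
lemma card_oddComponentSets (Γ : SimpleGraph W) (U : Finset W) :
    (oddComponentSets Γ U).card =
      ((⊤ : Γ.Subgraph).deleteVerts (U : Set W)).coe.oddComponents.ncard := by
  set K := ((⊤ : Γ.Subgraph).deleteVerts (U : Set W)).coe with hK
  have hv : ∀ x : W, x ∈ ((⊤ : Γ.Subgraph).deleteVerts (U : Set W)).verts ↔ x ∉ U := by simp
  have hadj : ∀ x y, K.Adj x y ↔ Γ.Adj x.1 y.1 := fun x y => by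
    have hx := (hv x).1 x.2
    have hy := (hv y).1 y.2
    simp [hK, hx, hy]
  let f : K.ConnectedComponent → Finset W := fun c => (Subtype.val '' c.supp).toFinset
  have hmem : ∀ c x, x ∈ f c ↔ ∃ h, K.connectedComponentMk ⟨x, h⟩ = c := fun c x => by
    simp [f]
  have hinj : Function.Injective f := by
    intro c c' h
    obtain ⟨x, rfl⟩ := c.exists_rep
    have : x.1 ∈ f (K.connectedComponentMk x) := (hmem _ _).2 ⟨x.2, rfl⟩
    have h2 : x.1 ∈ f c' := by rw [← h]; exact this
    obtain ⟨_, h3⟩ := (hmem _ _).1 h2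
    exact h3
  have hcard : ∀ c, (f c).card = c.supp.ncard := fun c => by
    rw [← Set.ncard_eq_toFinset_card', Set.ncard_image_of_injective _ Subtype.val_injective]
  have hclosed : ∀ c, ∀ x ∈ f c, ∀ y, Γ.Adj x y → y ∉ U → y ∈ f c := by
    intro c x hx y hxy hy
    obtain ⟨h1, h2⟩ := (hmem _ _).1 hx
    refine (hmem _ _).2 ⟨(hv y).2 hy, ?_⟩
    rw [← h2]
    exact ConnectedComponent.sound ((hadj ⟨x, h1⟩ ⟨y, (hv y).2 hy⟩).2 hxy).symm.reachable
  have hreach : ∀ (X : Finset W), (∀ x ∈ X, ∀ y, Γ.Adj x y → y ∉ U → y ∈ X) →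
      ∀ x y, K.Reachable x y → x.1 ∈ X → y.1 ∈ X := by
    rintro X hX x y ⟨w⟩
    induction w with
    | nil => exact id
    | cons h _ ih => exact fun hx => ih (hX _ hx _ ((hadj _ _).1 h) ((hv _).1 (Subtype.prop _)))
  have himage : (oddComponentSets Γ U : Set (Finset W)) = f '' K.oddComponents := by
    ext C
    simp only [Finset.mem_coe, mem_oddComponentSets, Set.mem_image]
    constructor
    · intro hC
      obtain ⟨x, hx⟩ : C.Nonempty := Finset.card_pos.1 hC.odd.pos
      have hxU := (hv x).2 (hC.disj x hx)
      have hsub : f (K.connectedComponentMk ⟨x, hxU⟩) ⊆ C := by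
        intro y hy
        obtain ⟨h1, h2⟩ := (hmem _ _).1 hy
        exact hreach C hC.closed _ _ (ConnectedComponent.exact h2).symm hx
      have heq : f (K.connectedComponentMk ⟨x, hxU⟩) = C :=
        Finset.Subset.antisymm hsub
          (hC.minimal _ hsub ⟨x, (hmem _ _).2 ⟨hxU, rfl⟩⟩ (hclosed _))
      refine ⟨_, ?_, heq⟩
      show Odd _
      rw [← hcard, heq]
      exact hC.odd
    · rintro ⟨c, hc, rfl⟩
      refine ⟨by rw [hcard]; exact hc, fun x hx => ?_, hclosed c, fun X hXc hne hX => ?_⟩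
      · obtain ⟨h1, _⟩ := (hmem _ _).1 hx
        exact (hv x).1 h1
      · intro y hy
        obtain ⟨x, hx⟩ := hne
        obtain ⟨h1, h2⟩ := (hmem _ _).1 hy
        obtain ⟨h3, h4⟩ := (hmem _ _).1 (hXc hx)
        exact hreach X hX _ _ (ConnectedComponent.exact (h4.trans h2.symm)) hx
  rw [← Set.ncard_image_of_injective _ hinj, ← himage, Set.ncard_coe_finset]

lemma even_card_oddComponentSets_add (Γ : SimpleGraph W) (U : Finset W) :
    Even ((oddComponentSets Γ U).card + U.card) ↔ Even (Fintype.card W) := by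
  classical
  have h := odd_ncard_oddComponents (G := ((⊤ : Γ.Subgraph).deleteVerts (U : Set W)).coe)
  rw [← card_oddComponentSets] at h
  have hc : Nat.card ((⊤ : Γ.Subgraph).deleteVerts (U : Set W)).verts + U.card
      = Fintype.card W := by
    have : ((⊤ : Γ.Subgraph).deleteVerts (U : Set W)).verts = ((Uᶜ : Finset W) : Set W) := by
      ext; simp
    rw [this, Nat.card_coe_set_eq, Set.ncard_coe_finset, add_comm, Finset.card_add_card_compl]
  rw [← hc, Nat.even_add, Nat.even_add]
  simp only [← Nat.not_odd_iff_even, h]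

open Classical in
/-- A graph of even order without perfect matching has a barrier each of whose vertices has
neighbours in three different odd components. -/
lemma exists_minimal_violator (Γ : SimpleGraph W) (hW : Even (Fintype.card W))
    (hM : ¬ ∃ M : Γ.Subgraph, M.IsPerfectMatching) :
    ∃ U : Finset W, U.card < (oddComponentSets Γ U).card ∧ ∀ x ∈ U,
      ∃ C₁ C₂ C₃ : Finset W, C₁ ≠ C₂ ∧ C₁ ≠ C₃ ∧ C₂ ≠ C₃ ∧
        IsOddComponent Γ U C₁ ∧ IsOddComponent Γ U C₂ ∧ IsOddComponent Γ U C₃ ∧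
        ∃ y₁ ∈ C₁, ∃ y₂ ∈ C₂, ∃ y₃ ∈ C₃, Γ.Adj x y₁ ∧ Γ.Adj x y₂ ∧ Γ.Adj x y₃ := by
  rw [SimpleGraph.tutte] at hM
  push Not at hM
  obtain ⟨u, hu⟩ := hM
  have hex : ∃ n, ∃ U : Finset W, U.card = n ∧ U.card < (oddComponentSets Γ U).card := by
    refine ⟨_, u.toFinset, rfl, ?_⟩
    rw [card_oddComponentSets]
    have := hu
    unfold IsTutteViolator at this
    rw [Set.ncard_eq_toFinset_card'] at this
    rwa [Set.coe_toFinset]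
  obtain ⟨U, hUn, hU⟩ := Nat.find_spec hex
  refine ⟨U, hU, fun x hx => ?_⟩
  have hmin : (oddComponentSets Γ (U.erase x)).card ≤ (U.erase x).card := by
    by_contra hlt
    push Not at hlt
    have := Nat.find_min' hex ⟨U.erase x, rfl, hlt⟩
    rw [← hUn] at this
    have := Finset.card_erase_lt_of_mem hx
    omega
  let touched := (oddComponentSets Γ U).filter (fun C => ∃ y ∈ C, Γ.Adj x y)
  have hsub : oddComponentSets Γ U \ touched ⊆ oddComponentSets Γ (U.erase x) := by
    intro C hC
    simp only [touched, Finset.mem_sdiff, Finset.mem_filter, not_and, not_exists,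
      mem_oddComponentSets] at hC ⊢
    obtain ⟨hC, hno⟩ := hC
    have hno := hno hC
    refine ⟨hC.odd, fun y hy h => hC.disj y hy (Finset.mem_of_mem_erase h),
      fun y hy z hyz hz => ?_, fun X hXC hne hX => hC.minimal X hXC hne
        fun y hy z hyz hz => hX y hy z hyz fun h => hz (Finset.mem_of_mem_erase h)⟩
    have hzx : z ≠ x := by rintro rfl; exact hno y hy hyz.symm
    exact hC.closed y hy z hyz fun h => hz (Finset.mem_erase.2 ⟨hzx, h⟩)
  have h1 := Finset.card_le_card hsub
  have h2 : (oddComponentSets Γ U \ touched).card + touched.card = (oddComponentSets Γ U).card :=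
    Finset.card_sdiff_add_card_eq_card (Finset.filter_subset _ _)
  have h3 := even_card_oddComponentSets_add Γ U
  have h4 := Finset.card_erase_add_one hx
  have h5 : 2 < touched.card := by
    have h6 := h3.2 hW
    rw [Nat.even_iff] at h6
    omega
  obtain ⟨C₁, C₂, C₃, hC₁, hC₂, hC₃, h12, h13, h23⟩ := Finset.two_lt_card_iff.1 h5
  simp only [touched, Finset.mem_filter, mem_oddComponentSets] at hC₁ hC₂ hC₃
  obtain ⟨o₁, y₁, hy₁, a₁⟩ := hC₁
  obtain ⟨o₂, y₂, hy₂, a₂⟩ := hC₂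
  obtain ⟨o₃, y₃, hy₃, a₃⟩ := hC₃
  exact ⟨C₁, C₂, C₃, h12, h13, h23, o₁, o₂, o₃, y₁, hy₁, y₂, hy₂, y₃, hy₃, a₁, a₂, a₃⟩

end Tutte

section DartSystems

/-- The darts of a graph on `V`, paired at every vertex into transitions by `p`, with some
families of transitions labelled by `ι`; `H` selects one dart of every transition. -/
structure DartSystem (D V ι : Type*) where
  base : D → V
  rev : D → D
  p : D → D
  label : D → Option ι
  H : Set D
  rev_rev : rev.Involutive
  base_rev : ∀ d, base (rev d) ≠ base d
  label_rev : ∀ d, label (rev d) = label d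
  p_p : p.Involutive
  p_ne : ∀ d, p d ≠ d
  base_p : ∀ d, base (p d) = base d
  label_p : ∀ d, label (p d) = label d
  mem_H : ∀ d, p d ∈ H ↔ d ∉ H

namespace DartSystem

variable {D V ι : Type*} (𝒟 : DartSystem D V ι)

/-- Sets of darts that are unions of closed trails of the transition system. -/
def IsClosed (S : Finset D) : Prop :=
  (∀ d ∈ S, 𝒟.rev d ∈ S) ∧ ∀ d ∈ S, 𝒟.p d ∈ S

/-- Two darts lie on the same closed trail of the transition system. -/
def Linked (d e : D) : Prop :=
  ∀ S, 𝒟.IsClosed S → (d ∈ S ↔ e ∈ S)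

lemma Linked.symm {d e : D} (h : 𝒟.Linked d e) : 𝒟.Linked e d := fun S hS => (h S hS).symm

lemma Linked.trans {d e f : D} (h : 𝒟.Linked d e) (h' : 𝒟.Linked e f) : 𝒟.Linked d f :=
  fun S hS => (h S hS).trans (h' S hS)

lemma linked_rev (d : D) : 𝒟.Linked d (𝒟.rev d) := fun S hS =>
  ⟨hS.1 d, fun h => by simpa [𝒟.rev_rev d] using hS.1 _ h⟩

lemma linked_p (d : D) : 𝒟.Linked d (𝒟.p d) := fun S hS =>
  ⟨hS.2 d, fun h => by simpa [𝒟.p_p d] using hS.2 _ h⟩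

open Classical in
lemma Linked.label_eq [Fintype D] {d e : D} (h : 𝒟.Linked d e) : 𝒟.label d = 𝒟.label e := by
  have := (h (Finset.univ.filter fun x => 𝒟.label x = 𝒟.label d)
    ⟨fun x hx => by simpa [𝒟.label_rev] using hx, fun x hx => by simpa [𝒟.label_p] using hx⟩).1
    (by simp)
  simpa [eq_comm] using this

/-- Adjacency in the auxiliary graph: its vertices are the transitions and two helpers for every
label. -/
def AuxAdj : 𝒟.H ⊕ ι × Bool → 𝒟.H ⊕ ι × Bool → Prop
  | .inl a, .inl b => a ≠ b ∧ (𝒟.base a = 𝒟.base b ∨ 𝒟.Linked a b)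
  | .inl a, .inr x => 𝒟.label a = some x.1
  | .inr x, .inl a => 𝒟.label a = some x.1
  | .inr _, .inr _ => False

/-- The auxiliary graph whose perfect matchings tell which transitions to keep. -/
def auxGraph : SimpleGraph (𝒟.H ⊕ ι × Bool) where
  Adj := 𝒟.AuxAdj
  symm := ⟨by
    rintro (a | x) (b | y) h
    · exact ⟨h.1.symm, h.2.imp Eq.symm (Linked.symm 𝒟)⟩
    · exact h
    · exact h
    · exact h⟩
  loopless := ⟨by
    rintro (a | x) h
    · exact h.1 rfl
    · exact h⟩

open Classical in
/-- A perfect matching of the auxiliary graph yields a balanced colouring of the darts that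
reverses at some transition of every label. -/
lemma exists_coloring_of_isPerfectMatching [Fintype D] [Fintype ι]
    (hlink : ∀ d e o, 𝒟.label d = some o → 𝒟.label e = some o → 𝒟.Linked d e)
    (M : 𝒟.auxGraph.Subgraph) (hM : M.IsPerfectMatching) :
    ∃ (c : D → ZMod 2) (p' : D → D), p'.Involutive ∧ (∀ d, 𝒟.base (p' d) = 𝒟.base d) ∧
      (∀ d, c (𝒟.rev d) = c d) ∧ (∀ d, c (p' d) = c d + 1) ∧
      ∀ o, ∃ d, 𝒟.label d = some o ∧ c (𝒟.p d) = c d + 1 := by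
  rw [Subgraph.isPerfectMatching_iff] at hM
  choose m hm hm' using hM
  have hmm : m.Involutive := fun w => (hm' (m w) w (hm w).symm).symm
  have hadj : ∀ w, 𝒟.auxGraph.Adj w (m w) := fun w => (hm w).adj_sub
  let Q : List (D × D) := ((Finset.univ : Finset (D × D)).filter fun q =>
    ∃ a b : 𝒟.H, a.1 = q.1 ∧ b.1 = q.2 ∧ m (.inl a) = .inl b ∧ 𝒟.base a = 𝒟.base b).toList
  have hQ : ∀ q, q ∈ Q ↔ ∃ a b : 𝒟.H, a.1 = q.1 ∧ b.1 = q.2 ∧ m (.inl a) = .inl b ∧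
      𝒟.base a = 𝒟.base b := fun q => by simp [Q]
  let T : Set D := {d | ∃ q ∈ Q, d = q.1 ∨ d = 𝒟.p q.1}
  have hT : ∀ d, d ∈ T ↔ ∃ q ∈ Q, d = q.1 ∨ d = 𝒟.p q.1 := fun d => Iff.rfl
  have hrne : ∀ d, 𝒟.rev d ≠ d := fun d h => 𝒟.base_rev d (by rw [h])
  have hdiv : DivisibleByFour 𝒟.rev 𝒟.p Q := by
    intro S hSr hSp hSQ
    have hS : 𝒟.IsClosed S := ⟨hSr, hSp⟩
    rw [card_eq_two_mul_transversal S 𝒟.p 𝒟.p_p hSp 𝒟.H 𝒟.mem_H, ← Finset.card_subtype]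
    let B : Finset (ι × Bool) := (Finset.univ.filter fun o => ∃ d ∈ S, 𝒟.label d = some o) ×ˢ
      Finset.univ
    have hX : Even ((S.subtype (· ∈ 𝒟.H)).disjSum B).card := by
      refine even_card_of_involution _ m (fun d _ => hmm d) (fun d _ => (hadj d).ne') ?_
      rintro (a | x) ha
      · rw [Finset.inl_mem_disjSum, Finset.mem_subtype] at ha
        rcases hma : m (.inl a) with b | y
        · rw [Finset.inl_mem_disjSum, Finset.mem_subtype]
          have h := hadj (.inl a)
          rw [hma] at h
          rcases h.2 with h | h
          · exact (hSQ (a.1, b.1) ((hQ _).2 ⟨a, b, rfl, rfl, hma, h⟩)).1 ha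
          · exact (h S hS).1 ha
        · have h := hadj (.inl a)
          rw [hma] at h
          rw [Finset.inr_mem_disjSum]
          simp only [B, Finset.mem_product, Finset.mem_filter, Finset.mem_univ, true_and, and_true]
          exact ⟨a, ha, h⟩
      · rw [Finset.inr_mem_disjSum] at ha
        simp only [B, Finset.mem_product, Finset.mem_filter, Finset.mem_univ, true_and,
          and_true] at ha
        obtain ⟨d, hd, hdx⟩ := ha
        have h := hadj (.inr x)
        rcases hma : m (.inr x) with b | y
        · rw [hma] at h
          rw [Finset.inl_mem_disjSum, Finset.mem_subtype]
          exact (hlink d b x.1 hdx h S hS).1 hd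
        · rw [hma] at h
          exact h.elim
    rw [Finset.card_disjSum, Finset.card_product, Finset.card_univ, Fintype.card_bool,
      Nat.even_add] at hX
    have := hX.2 (by simp)
    obtain ⟨k, hk⟩ := this
    exact ⟨k, by omega⟩
  obtain ⟨p', hp', hpne', hβ', hT', hdiv'⟩ := DivisibleByFour.exists_repairing 𝒟.rev_rev hrne
    𝒟.base T Q 𝒟.p 𝒟.p_p 𝒟.p_ne 𝒟.base_p (by
      rintro d ⟨q, hq, rfl | rfl⟩
      · exact ⟨q, hq, Or.inr rfl⟩
      · exact ⟨q, hq, Or.inl (𝒟.p_p _)⟩)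
    (by
      intro q hq
      refine ⟨?_, ⟨q, hq, Or.inl rfl⟩, ?_⟩
      · obtain ⟨a, b, h1, h2, -, h4⟩ := (hQ q).1 hq
        rw [← h1, ← h2, h4]
      · refine ⟨(q.2, q.1), (hQ _).2 ?_, Or.inl rfl⟩
        obtain ⟨a, b, h1, h2, h3, h4⟩ := (hQ q).1 hq
        exact ⟨b, a, h2, h1, by rw [← h3, hmm], h4.symm⟩) hdiv
  obtain ⟨c, hc, hcp⟩ := exists_alternating_coloring 𝒟.rev p' 𝒟.rev_rev hp' hpne'
    (fun S h1 h2 => hdiv' S h1 h2 (by simp))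
  refine ⟨c, p', hp', hβ', hc, hcp, fun o => ?_⟩
  have h := hadj (.inr (o, true))
  rcases hma : m (.inr (o, true)) with a | y
  · rw [hma] at h
    have hma' : m (.inl a) = .inr (o, true) := by rw [← hma, hmm]
    have haT : a.1 ∉ T := by
      rintro ⟨q, hq, h1⟩
      obtain ⟨b, b', hb, -, hbm, -⟩ := (hQ q).1 hq
      rcases h1 with h1 | h1
      · have : a = b := Subtype.ext (by rw [h1, hb])
        rw [← this, hma'] at hbm
        cases hbm
      · have h2 := a.2
        rw [h1, 𝒟.mem_H, ← hb] at h2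
        exact h2 b.2
    exact ⟨a, h, by rw [← hT' a haT, hcp]⟩
  · rw [hma] at h
    exact h.elim

variable {𝒟}

/-- `U` contains no helper and is a union of label classes. -/
def IsUnionOfLabels (𝒟 : DartSystem D V ι) (U : Finset (𝒟.H ⊕ ι × Bool)) : Prop :=
  (∀ x, Sum.inr x ∉ U) ∧ ∀ a : 𝒟.H, Sum.inl a ∈ U →
    ∃ o, 𝒟.label a = some o ∧ ∀ b : 𝒟.H, 𝒟.label b = some o → Sum.inl b ∈ U

lemma isUnionOfLabels_of_minimal [Fintype D] [Fintype ι]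
    (hlink : ∀ d e o, 𝒟.label d = some o → 𝒟.label e = some o → 𝒟.Linked d e)
    (U : Finset (𝒟.H ⊕ ι × Bool))
    (h3 : ∀ x ∈ U, ∃ C₁ C₂ C₃, C₁ ≠ C₂ ∧ C₁ ≠ C₃ ∧ C₂ ≠ C₃ ∧
        IsOddComponent 𝒟.auxGraph U C₁ ∧ IsOddComponent 𝒟.auxGraph U C₂ ∧
        IsOddComponent 𝒟.auxGraph U C₃ ∧ ∃ y₁ ∈ C₁, ∃ y₂ ∈ C₂, ∃ y₃ ∈ C₃,
          𝒟.auxGraph.Adj x y₁ ∧ 𝒟.auxGraph.Adj x y₂ ∧ 𝒟.auxGraph.Adj x y₃) :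
    𝒟.IsUnionOfLabels U := by
  have merge : ∀ C C', IsOddComponent 𝒟.auxGraph U C → IsOddComponent 𝒟.auxGraph U C' →
      ∀ a b : 𝒟.H, .inl a ∈ C → .inl b ∈ C' → (𝒟.base a = 𝒟.base b ∨ 𝒟.Linked a b) →
      C = C' := by
    intro C C' hC hC' a b ha hb h
    by_cases hab : a = b
    · exact hC.eq_of_mem hC' ha (hab ▸ hb)
    · exact hC.eq_of_mem hC' (hC.closed _ ha (.inl b) ⟨hab, h⟩ (hC'.disj _ hb)) hb
  constructor
  · intro x hx
    obtain ⟨C₁, C₂, C₃, h12, -, -, o₁, o₂, -, y₁, hy₁, y₂, hy₂, y₃, -, a₁, a₂, -⟩ := h3 _ hx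
    rcases y₁ with b₁ | z
    · rcases y₂ with b₂ | z
      · exact h12 (merge _ _ o₁ o₂ _ _ hy₁ hy₂ (Or.inr (hlink _ _ x.1 a₁ a₂)))
      · exact a₂.elim
    · exact a₁.elim
  · intro a ha
    by_contra hcon
    push Not at hcon
    obtain ⟨C₁, C₂, C₃, h12, h13, h23, o₁, o₂, o₃, y₁, hy₁, y₂, hy₂, y₃, hy₃, a₁, a₂, a₃⟩ :=
      h3 _ ha
    let P : 𝒟.H ⊕ ι × Bool → Prop := fun y => ∃ c : 𝒟.H, y = .inl c ∧ 𝒟.base a = 𝒟.base c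
    have hP : ∀ C C', IsOddComponent 𝒟.auxGraph U C → IsOddComponent 𝒟.auxGraph U C' →
        ∀ y ∈ C, ∀ y' ∈ C', P y → P y' → C = C' := by
      rintro C C' hC hC' y hy y' hy' ⟨c, rfl, hc⟩ ⟨c', rfl, hc'⟩
      exact merge _ _ hC hC' _ _ hy hy' (Or.inl (hc.symm.trans hc'))
    obtain ⟨R, hPR, hR⟩ : ∃ R : 𝒟.H ⊕ ι × Bool → Prop,
        (∀ y, 𝒟.auxGraph.Adj (.inl a) y → P y ∨ R y) ∧
        ∀ C C', IsOddComponent 𝒟.auxGraph U C → IsOddComponent 𝒟.auxGraph U C' →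
          ∀ y ∈ C, ∀ y' ∈ C', R y → R y' → C = C' := by
      rcases hl : 𝒟.label a with _ | o
      · refine ⟨fun y => ∃ c : 𝒟.H, y = .inl c ∧ 𝒟.Linked a c, ?_, ?_⟩
        · rintro (c | x) h
          · rcases h.2 with h | h
            · exact Or.inl ⟨c, rfl, h⟩
            · exact Or.inr ⟨c, rfl, h⟩
          · have h' : 𝒟.label a = some x.1 := h
            rw [hl] at h'
            cases h'
        · rintro C C' hC hC' y hy y' hy' ⟨c, rfl, hc⟩ ⟨c', rfl, hc'⟩
          exact merge _ _ hC hC' _ _ hy hy' (Or.inr (Linked.trans 𝒟 (Linked.symm 𝒟 hc) hc'))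
      · obtain ⟨b, hb, hbU⟩ := hcon o hl
        refine ⟨fun y => y = .inl b ∨ 𝒟.auxGraph.Adj y (.inl b), ?_, ?_⟩
        · rintro (c | x) h
          · rcases h.2 with h | h
            · exact Or.inl ⟨c, rfl, h⟩
            · refine Or.inr ?_
              by_cases hcb : c = b
              · exact Or.inl (by rw [hcb])
              · exact Or.inr ⟨hcb, Or.inr (Linked.trans 𝒟 (Linked.symm 𝒟 h) (hlink _ _ o hl hb))⟩
          · have h' : 𝒟.label a = some x.1 := h
            refine Or.inr (Or.inr ?_)
            show 𝒟.label b = some x.1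
            rw [hb, ← hl, h']
        · have key : ∀ C, IsOddComponent 𝒟.auxGraph U C → ∀ y ∈ C,
              (y = .inl b ∨ 𝒟.auxGraph.Adj y (.inl b)) → .inl b ∈ C := by
            rintro C hC y hy (rfl | h)
            · exact hy
            · exact hC.closed _ hy _ h hbU
          intro C C' hC hC' y hy y' hy' h h'
          exact hC.eq_of_mem hC' (key C hC y hy h) (key C' hC' y' hy' h')
    have p12 := hP _ _ o₁ o₂ _ hy₁ _ hy₂
    have p13 := hP _ _ o₁ o₃ _ hy₁ _ hy₃
    have p23 := hP _ _ o₂ o₃ _ hy₂ _ hy₃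
    have r12 := hR _ _ o₁ o₂ _ hy₁ _ hy₂
    have r13 := hR _ _ o₁ o₃ _ hy₁ _ hy₃
    have r23 := hR _ _ o₂ o₃ _ hy₂ _ hy₃
    have q1 := hPR _ a₁
    have q2 := hPR _ a₂
    have q3 := hPR _ a₃
    rcases q1 with q1 | q1 <;> rcases q2 with q2 | q2 <;> rcases q3 with q3 | q3 <;>
    first
    | exact h12 (p12 q1 q2)
    | exact h12 (r12 q1 q2)
    | exact h13 (p13 q1 q3)
    | exact h13 (r13 q1 q3)
    | exact h23 (p23 q2 q3)
    | exact h23 (r23 q2 q3)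

open Classical in
/-- The removed transitions at vertices that meet `C`. -/
noncomputable def boundary [Fintype D] (U C : Finset (𝒟.H ⊕ ι × Bool)) : Finset 𝒟.H :=
  Finset.univ.filter fun a => .inl a ∈ U ∧ ∃ b : 𝒟.H, .inl b ∈ C ∧ 𝒟.base b = 𝒟.base a

lemma mem_boundary [Fintype D] {U C : Finset (𝒟.H ⊕ ι × Bool)} {a : 𝒟.H} :
    a ∈ boundary U C ↔ .inl a ∈ U ∧ ∃ b : 𝒟.H, .inl b ∈ C ∧ 𝒟.base b = 𝒟.base a := by
  simp [boundary]

open Classical in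
/-- The number of transitions at any set of vertices is even. -/
lemma even_card_transitions [Fintype D]
    (hdeg : ∀ v, 4 ∣ (Finset.univ.filter fun d => 𝒟.base d = v).card) (A : Set V) :
    Even (Finset.univ.filter fun a : 𝒟.H => 𝒟.base a ∈ A).card := by
  let S : Finset D := Finset.univ.filter fun d => 𝒟.base d ∈ A
  have h4 : 4 ∣ S.card := by
    rw [Finset.card_eq_sum_card_image 𝒟.base S]
    refine Finset.dvd_sum fun v hv => ?_
    obtain ⟨d, hd, rfl⟩ := Finset.mem_image.1 hv
    have hfib : (S.filter fun e => 𝒟.base e = 𝒟.base d) =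
        Finset.univ.filter fun e => 𝒟.base e = 𝒟.base d := by
      ext e
      simp only [S, Finset.mem_filter, Finset.mem_univ, true_and] at hd ⊢
      exact ⟨fun h => h.2, fun h => ⟨h ▸ hd, h⟩⟩
    rw [hfib]
    exact hdeg _
  rw [card_eq_two_mul_transversal S 𝒟.p 𝒟.p_p (by simp [S, 𝒟.base_p]) 𝒟.H 𝒟.mem_H,
    ← Finset.card_subtype] at h4
  have : S.subtype (· ∈ 𝒟.H) = Finset.univ.filter fun a : 𝒟.H => 𝒟.base a ∈ A := by
    ext a; simp [S]
  rw [this] at h4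
  obtain ⟨k, hk⟩ := h4
  exact ⟨k, by omega⟩

open Classical in
lemma odd_card_boundary [Fintype D] [Fintype ι]
    (hdeg : ∀ v, 4 ∣ (Finset.univ.filter fun d => 𝒟.base d = v).card)
    (hne : ∀ o, ∃ a : 𝒟.H, 𝒟.label a = some o)
    {U C : Finset (𝒟.H ⊕ ι × Bool)} (hU : 𝒟.IsUnionOfLabels U)
    (hC : IsOddComponent 𝒟.auxGraph U C)
    (hhelp : ∀ o i, .inr (o, i) ∈ C → ∀ a : 𝒟.H, 𝒟.label a = some o → .inl a ∉ U) :
    Odd (boundary U C).card := by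
  obtain ⟨A, hAdef⟩ : ∃ A : Set V, ∀ v, v ∈ A ↔ ∃ b : 𝒟.H, .inl b ∈ C ∧ 𝒟.base b = v :=
    ⟨{v | _}, fun _ => Iff.rfl⟩
  have hA := even_card_transitions hdeg A
  have hsplit : (Finset.univ.filter fun a : 𝒟.H => 𝒟.base a ∈ A) = C.toLeft ∪ boundary U C := by
    ext a
    simp only [Finset.mem_filter, Finset.mem_univ, true_and, Finset.mem_union, Finset.mem_toLeft,
      mem_boundary, hAdef]
    constructor
    · rintro ⟨b, hb, hba⟩
      by_cases haU : .inl a ∈ U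
      · exact Or.inr ⟨haU, b, hb, hba⟩
      · by_cases hab : b = a
        · exact Or.inl (hab ▸ hb)
        · exact Or.inl (hC.closed _ hb (.inl a) ⟨hab, Or.inl hba⟩ haU)
    · rintro (h | ⟨-, h⟩)
      · exact ⟨a, h, rfl⟩
      · exact h
  have hdis : Disjoint C.toLeft (boundary U C) := by
    rw [Finset.disjoint_left]
    intro a ha hb
    exact hC.disj _ (Finset.mem_toLeft.1 ha) (mem_boundary.1 hb).1
  have hright : Even C.toRight.card := by
    refine even_card_of_involution _ (fun x => (x.1, !x.2)) (fun x _ => by simp)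
      (fun x _ h => by simpa using congrArg Prod.snd h) ?_
    rintro ⟨o, i⟩ hx
    rw [Finset.mem_toRight] at hx ⊢
    obtain ⟨a, ha⟩ := hne o
    exact hC.closed (.inl a) (hC.closed _ hx (.inl a) ha (hhelp o i hx a ha)) (.inr (o, !i)) ha
      (hU.1 _)
  have hodd := hC.odd
  rw [← Finset.card_toLeft_add_card_toRight, Nat.odd_add] at hodd
  rw [hsplit, Finset.card_union_of_disjoint hdis, Nat.even_add, ← Nat.not_odd_iff_even,
    ← Nat.not_odd_iff_even] at hA
  have := hodd.2 hright
  tauto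

/-- Every dart lies in a transition represented in `H`. -/
lemma exists_transition (d : D) :
    ∃ a : 𝒟.H, 𝒟.base a = 𝒟.base d ∧ 𝒟.label a = 𝒟.label d ∧ 𝒟.Linked d a := by
  by_cases hd : d ∈ 𝒟.H
  · exact ⟨⟨d, hd⟩, rfl, rfl, fun _ _ => Iff.rfl⟩
  · exact ⟨⟨𝒟.p d, (𝒟.mem_H d).2 hd⟩, 𝒟.base_p d, 𝒟.label_p d, 𝒟.linked_p d⟩

open Classical in
lemma card_boundary_ne_one [Fintype D] [Fintype ι]
    (hcut : ∀ (v : V) (A : Set V), (∃ a ∈ A, a ≠ v) → (∃ w ∉ A, w ≠ v) →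
      ∃ d, 𝒟.base d ∈ A ∧ 𝒟.base d ≠ v ∧ 𝒟.base (𝒟.rev d) ∉ A)
    {U C : Finset (𝒟.H ⊕ ι × Bool)} (hU : 𝒟.IsUnionOfLabels U)
    (hC : IsOddComponent 𝒟.auxGraph U C) :
    (boundary U C).card ≠ 1 := by
  intro h1
  obtain ⟨t, ht⟩ := Finset.card_eq_one.1 h1
  have htb : t ∈ boundary U C := by simp [ht]
  have huniq : ∀ a ∈ boundary U C, a = t := fun a ha => by simpa [ht] using ha
  obtain ⟨htU, b, hb, hbt⟩ := mem_boundary.1 htb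
  have hUl : ∀ a c : 𝒟.H, .inl a ∈ U → 𝒟.label a = 𝒟.label c → .inl c ∈ U := by
    intro a c ha hac
    obtain ⟨o, ho, hall⟩ := hU.2 a ha
    exact hall c (by rw [← hac, ho])
  -- crossing an edge not in `U` stays inside the component
  have hcross : ∀ (a : 𝒟.H) d, .inl a ∈ C → 𝒟.Linked d a →
      ∃ c : 𝒟.H, .inl c ∈ C ∧ 𝒟.base c = 𝒟.base (𝒟.rev d) := by
    intro a d ha hda
    obtain ⟨c, hc1, hc2, hc3⟩ := exists_transition (𝒟.rev d)
    refine ⟨c, ?_, hc1⟩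
    have hac : 𝒟.Linked a c :=
      Linked.trans 𝒟 (Linked.symm 𝒟 hda) (Linked.trans 𝒟 (𝒟.linked_rev d) hc3)
    by_cases h : a = c
    · exact h ▸ ha
    · refine hC.closed _ ha (.inl c) ⟨h, Or.inr hac⟩ fun hcU => hC.disj _ ha ?_
      exact hUl c a hcU (Linked.label_eq 𝒟 hac).symm
  let A : Set V := {v | ∃ b : 𝒟.H, .inl b ∈ C ∧ 𝒟.base b = v}
  obtain ⟨d, hdA, hdv, hdA'⟩ := hcut (𝒟.base t) A (by
    obtain ⟨c, hc, hcb⟩ := hcross b b hb (fun _ _ => Iff.rfl)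
    exact ⟨_, ⟨c, hc, rfl⟩, by rw [hcb, ← hbt]; exact 𝒟.base_rev _⟩) (by
    obtain ⟨c, hc1, hc2, hc3⟩ := exists_transition (𝒟.rev t)
    have hne : 𝒟.base c ≠ 𝒟.base t := by rw [hc1]; exact 𝒟.base_rev _
    refine ⟨𝒟.base c, ?_, hne⟩
    rintro ⟨b', hb', hbc⟩
    refine hne (congrArg (fun x : 𝒟.H => 𝒟.base x) (huniq c (mem_boundary.2 ⟨?_, b', hb', hbc⟩)))
    exact hUl t c htU (by rw [hc2, 𝒟.label_rev]))
  obtain ⟨a, ha1, ha2, ha3⟩ := exists_transition d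
  obtain ⟨b', hb', hbd⟩ := hdA
  by_cases haU : .inl a ∈ U
  · have := huniq a (mem_boundary.2 ⟨haU, b', hb', by rw [hbd, ha1]⟩)
    exact hdv (by rw [← ha1, this])
  · refine hdA' (hcross a d ?_ ha3)
    by_cases h : b' = a
    · exact h ▸ hb'
    · exact hC.closed _ hb' (.inl a) ⟨h, Or.inl (by rw [hbd, ha1])⟩ haU

open Classical in
theorem exists_isPerfectMatching [Fintype D] [Fintype ι]
    (hlink : ∀ d e o, 𝒟.label d = some o → 𝒟.label e = some o → 𝒟.Linked d e)
    (hdeg : ∀ v, 4 ∣ (Finset.univ.filter fun d => 𝒟.base d = v).card)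
    (hcut : ∀ (v : V) (A : Set V), (∃ a ∈ A, a ≠ v) → (∃ w ∉ A, w ≠ v) →
      ∃ d, 𝒟.base d ∈ A ∧ 𝒟.base d ≠ v ∧ 𝒟.base (𝒟.rev d) ∉ A)
    (hthree : ∀ o, 3 ≤ (Finset.univ.filter fun a : 𝒟.H => 𝒟.label a = some o).card) :
    ∃ M : 𝒟.auxGraph.Subgraph, M.IsPerfectMatching := by
  by_contra hM
  have hW : Even (Fintype.card (𝒟.H ⊕ ι × Bool)) := by
    rw [Fintype.card_sum, Fintype.card_prod, Fintype.card_bool]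
    have := even_card_transitions hdeg Set.univ
    simp only [Set.mem_univ, Finset.filter_true, Finset.card_univ] at this
    exact this.add (by simp)
  obtain ⟨U, hlt, h3⟩ := exists_minimal_violator 𝒟.auxGraph hW hM
  have hU := isUnionOfLabels_of_minimal hlink U h3
  have hne : ∀ o, ∃ a : 𝒟.H, 𝒟.label a = some o := fun o => by
    have := hthree o
    obtain ⟨a, ha⟩ := Finset.card_pos.1
      (by omega : 0 < (Finset.univ.filter fun a : 𝒟.H => 𝒟.label a = some o).card)
    exact ⟨a, (Finset.mem_filter.1 ha).2⟩
  let S : Finset ι := Finset.univ.filter fun o => ∃ a : 𝒟.H, 𝒟.label a = some o ∧ .inl a ∈ U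
  let bad := (oddComponentSets 𝒟.auxGraph U).filter fun C => ∃ x : ι × Bool, .inr x ∈ C ∧ x.1 ∈ S
  let good := (oddComponentSets 𝒟.auxGraph U).filter
    fun C => ¬ ∃ x : ι × Bool, .inr x ∈ C ∧ x.1 ∈ S
  have hsum : bad.card + good.card = (oddComponentSets 𝒟.auxGraph U).card :=
    Finset.card_filter_add_card_filter_not _
  have hbad : bad.card ≤ S.card * 2 := by
    have : ∀ C ∈ bad, ∃ x : ι × Bool, .inr x ∈ C ∧ x.1 ∈ S := fun C hC =>
      (Finset.mem_filter.1 hC).2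
    choose f hf using this
    have hle : bad.attach.card ≤ (S ×ˢ (Finset.univ : Finset Bool)).card := by
      refine Finset.card_le_card_of_injOn (fun C => f C.1 C.2) (fun C _ => ?_)
        (fun C _ C' _ (h : f C.1 C.2 = f C'.1 C'.2) => Subtype.ext ?_)
      · simpa using (hf C.1 C.2).2
      · have h1 := (hf C.1 C.2).1
        have h2 := (hf C'.1 C'.2).1
        rw [← h] at h2
        exact (mem_oddComponentSets.1 (Finset.mem_filter.1 C.2).1).eq_of_mem
          (mem_oddComponentSets.1 (Finset.mem_filter.1 C'.2).1) h1 h2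
    simpa using hle
  have hS : S.card * 3 ≤ U.toLeft.card := by
    have hsub : S.biUnion (fun o => Finset.univ.filter fun a : 𝒟.H => 𝒟.label a = some o) ⊆
        U.toLeft := by
      intro a ha
      simp only [S, Finset.mem_biUnion, Finset.mem_filter, Finset.mem_univ, true_and] at ha
      obtain ⟨o, ⟨b, hb, hbU⟩, hao⟩ := ha
      obtain ⟨o', ho', hall⟩ := hU.2 b hbU
      exact Finset.mem_toLeft.2 (hall a (by rw [hao, ← hb, ho']))
    refine le_trans ?_ (Finset.card_le_card hsub)
    rw [Finset.card_biUnion, ← smul_eq_mul]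
    · exact Finset.card_nsmul_le_sum _ _ _ fun o _ => hthree o
    · intro o _ o' _ hoo
      simp only [Function.onFun, Finset.disjoint_left]
      intro a ha ha'
      simp only [Finset.mem_filter, Finset.mem_univ, true_and] at ha ha'
      exact hoo (Option.some.inj (ha.symm.trans ha'))
  have hgood : good.card * 3 ≤ U.toLeft.card := by
    have hsub : good.biUnion (fun C => boundary U C) ⊆ U.toLeft := by
      intro a ha
      obtain ⟨C, -, hC⟩ := Finset.mem_biUnion.1 ha
      exact Finset.mem_toLeft.2 (mem_boundary.1 hC).1
    refine le_trans ?_ (Finset.card_le_card hsub)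
    rw [Finset.card_biUnion, ← smul_eq_mul]
    · refine Finset.card_nsmul_le_sum _ _ _ fun C hC => ?_
      obtain ⟨hC, hno⟩ := Finset.mem_filter.1 hC
      rw [mem_oddComponentSets] at hC
      have hhelp : ∀ o i, .inr (o, i) ∈ C → ∀ a : 𝒟.H, 𝒟.label a = some o → .inl a ∉ U :=
        fun o i hx a ha haU => hno ⟨(o, i), hx, by simpa [S] using ⟨a.1, ha, a.2, haU⟩⟩
      have h1 := odd_card_boundary hdeg hne hU hC hhelp
      have h2 := card_boundary_ne_one hcut hU hC
      obtain ⟨k, hk⟩ := h1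
      omega
    · intro C hC C' hC' hCC
      simp only [Function.onFun, Finset.disjoint_left]
      intro a ha ha'
      obtain ⟨-, b, hb, hba⟩ := mem_boundary.1 ha
      obtain ⟨-, b', hb', hba'⟩ := mem_boundary.1 ha'
      have oC := mem_oddComponentSets.1 (Finset.mem_filter.1 hC).1
      have oC' := mem_oddComponentSets.1 (Finset.mem_filter.1 hC').1
      apply hCC
      by_cases h : b = b'
      · exact oC.eq_of_mem oC' hb (h ▸ hb')
      · exact oC.eq_of_mem oC'
          (oC.closed _ hb (.inl b') ⟨h, Or.inl (hba.trans hba'.symm)⟩ (oC'.disj _ hb')) hb'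
  have := Finset.card_toLeft_add_card_toRight (u := U)
  omega

end DartSystem

end DartSystems

section Graphs

variable {V : Type*} {G : SimpleGraph V}

/-- The spanning subgraph of the edges of colour `1`. -/
def colorSubgraph (c : G.Dart → ZMod 2) (hc : ∀ d, c d.symm = c d) : G.Subgraph where
  verts := Set.univ
  Adj u v := ∃ h : G.Adj u v, c ⟨(u, v), h⟩ = 1
  adj_sub h := h.1
  edge_vert _ := Set.mem_univ _
  symm := ⟨fun _ _ h => ⟨h.1.symm, (hc ⟨(_, _), h.1⟩).trans h.2⟩⟩

lemma edge_mem_colorSubgraph {c : G.Dart → ZMod 2} {hc : ∀ d, c d.symm = c d} (d : G.Dart) :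
    d.edge ∈ (colorSubgraph c hc).edgeSet ↔ c d = 1 :=
  ⟨fun h => h.2, fun h => ⟨d.adj, h⟩⟩

variable [Fintype V]

open Classical in
/-- The degree of a vertex in a subgraph counts darts. -/
lemma card_darts (K : G.Subgraph) (v : V) :
    (Finset.univ.filter fun d : G.Dart => d.fst = v ∧ d.edge ∈ K.edgeSet).card = sdeg K v := by
  rw [sdeg, ← Set.ncard_coe_finset, ← Set.InjOn.ncard_image (f := fun d : G.Dart => d.snd)]
  · congr 1
    ext u
    simp only [Finset.coe_filter, Finset.mem_univ, true_and, Set.mem_image, Set.mem_ofPred_eq,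
      Subgraph.mem_neighborSet]
    constructor
    · rintro ⟨d, ⟨rfl, hd⟩, rfl⟩
      exact hd
    · intro h
      exact ⟨⟨(v, u), h.adj_sub⟩, ⟨rfl, h⟩, rfl⟩
  · intro d hd e he hde
    simp only [Finset.coe_filter, Finset.mem_univ, true_and, Set.mem_ofPred_eq] at hd he
    exact Dart.ext _ _ (Prod.ext (hd.1.trans he.1.symm) hde)

open Classical in
lemma card_darts_of_isRegular {r : ℕ} (hreg : IsRegular G r) (v : V) :
    (Finset.univ.filter fun d : G.Dart => d.fst = v).card = r := by
  rw [← hreg v, ← Subgraph.neighborSet_top, ← sdeg, ← card_darts]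
  congr 1
  ext d
  simp

open Classical in
/-- Edge-disjoint cycles and an even regular graph give a dart system in which consecutive darts
of each cycle are paired. -/
lemma exists_dartSystem {r : ℕ} (hr : Even r) (hreg : IsRegular G r) (𝒪 : Set G.Subgraph)
    (hcyc : ∀ O ∈ 𝒪, IsCycleSG O) (hdisj : PairwiseEdgeDisjoint 𝒪) :
    ∃ 𝒟 : DartSystem G.Dart V 𝒪, (∀ d, 𝒟.base d = d.fst) ∧ (∀ d, 𝒟.rev d = d.symm) ∧
      ∀ d O, 𝒟.label d = some O ↔ d.edge ∈ O.1.edgeSet := by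
  obtain ⟨lab, hlab⟩ : ∃ lab : G.Dart → Option 𝒪,
      ∀ d O, lab d = some O ↔ d.edge ∈ O.1.edgeSet := by
    refine ⟨fun d => if h : ∃ O : 𝒪, d.edge ∈ O.1.edgeSet then some h.choose else none,
      fun d O => ?_⟩
    by_cases h : ∃ O : 𝒪, d.edge ∈ O.1.edgeSet
    · simp only [h, dite_true, Option.some.injEq]
      refine ⟨fun h' => h' ▸ h.choose_spec, fun h' => ?_⟩
      by_contra hne
      exact Set.disjoint_left.1
        (hdisj h.choose.2 O.2 fun h' => hne (Subtype.ext h')) h.choose_spec h'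
    · simp only [h, dite_false, reduceCtorEq, false_iff]
      exact fun h' => h ⟨O, h'⟩
  have hsome : ∀ v (O : 𝒪),
      Even (Finset.univ.filter fun d : G.Dart => d.fst = v ∧ lab d = some O).card := by
    intro v O
    simp only [hlab, card_darts]
    by_cases hv : v ∈ O.1.verts
    · rw [(hcyc O O.2).2 v hv]
      exact even_two
    · have : O.1.neighborSet v = ∅ := by
        ext u
        simpa using fun h : O.1.Adj v u => hv (O.1.edge_vert h)
      simp [sdeg, this]
  have hall : ∀ v o,
      Even (Finset.univ.filter fun d : G.Dart => d.fst = v ∧ lab d = o).card := by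
    rintro v (_ | O)
    · have h := card_darts_of_isRegular hreg v
      rw [Finset.card_eq_sum_card_fiberwise (f := lab) (t := Finset.univ) (by simp)] at h
      simp only [Finset.filter_filter, Fintype.sum_option] at h
      rw [← h, Nat.even_add] at hr
      exact hr.2 (Finset.even_sum _ fun O _ => hsome v O)
    · exact hsome v O
  obtain ⟨p, hp, hpne, hpf⟩ := exists_involution_of_even_fibers
    (fun d : G.Dart => (d.fst, lab d)) (by
      rintro ⟨v, o⟩
      rw [Nat.card_eq_fintype_card, Fintype.card_subtype]
      simpa only [Prod.mk.injEq] using hall v o)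
  obtain ⟨H, hH⟩ := exists_transversal p hp hpne
  exact ⟨{
    base := fun d => d.fst
    rev := Dart.symm
    p := p
    label := lab
    H := H
    rev_rev := Dart.symm_involutive
    base_rev := fun d => d.adj.ne'
    label_rev := fun d => by
      ext O
      simp only [hlab, Dart.edge_symm]
    p_p := hp
    p_ne := hpne
    base_p := fun d => (Prod.ext_iff.1 (hpf d)).1
    label_p := fun d => (Prod.ext_iff.1 (hpf d)).2
    mem_H := hH }, fun _ => rfl, fun _ => rfl, hlab⟩

/-- All darts of a cycle of the family lie on the same closed trail. -/
lemma linked_of_label_eq {𝒪 : Set G.Subgraph} (hcyc : ∀ O ∈ 𝒪, IsCycleSG O)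
    {𝒟 : DartSystem G.Dart V 𝒪} (hbase : ∀ d, 𝒟.base d = d.fst) (hrev : ∀ d, 𝒟.rev d = d.symm)
    (hlab : ∀ d O, 𝒟.label d = some O ↔ d.edge ∈ O.1.edgeSet) (d e : G.Dart) (O : 𝒪)
    (hd : 𝒟.label d = some O) (he : 𝒟.label e = some O) : 𝒟.Linked d e := by
  classical
  have hvert : ∀ d : G.Dart, 𝒟.label d = some O → d.fst ∈ O.1.verts := fun d hd =>
    O.1.edge_vert (show O.1.Adj d.fst d.snd from (hlab d O).1 hd)
  have hfib : ∀ S, 𝒟.IsClosed S → ∀ d e : G.Dart, 𝒟.label d = some O → 𝒟.label e = some O →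
      e.fst = d.fst → d ∈ S → e ∈ S := by
    intro S hS d e hd he hde hdS
    by_contra heS
    have h2 := card_darts O.1 d.fst
    rw [(hcyc O O.2).2 _ (hvert d hd)] at h2
    have h3 : 2 < (Finset.univ.filter fun x : G.Dart => x.fst = d.fst ∧
        x.edge ∈ O.1.edgeSet).card := by
      rw [Finset.two_lt_card]
      refine ⟨d, ?_, 𝒟.p d, ?_, e, ?_, (𝒟.p_ne d).symm, ?_, ?_⟩
      · simpa using (hlab _ _).1 hd
      · simpa [← hbase, 𝒟.base_p] using (hlab _ _).1 ((𝒟.label_p d).trans hd)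
      · simpa [hde] using (hlab _ _).1 he
      · rintro rfl
        exact heS hdS
      · rintro rfl
        exact heS (hS.2 _ hdS)
    omega
  have main : ∀ S, 𝒟.IsClosed S → ∀ d e : G.Dart, 𝒟.label d = some O → 𝒟.label e = some O →
      d ∈ S → e ∈ S := by
    intro S hS d e hd he hdS
    have hwalk : ∀ x y : O.1.verts, O.1.coe.Walk x y →
        (∀ f : G.Dart, 𝒟.label f = some O → f.fst = x → f ∈ S) →
        ∀ f : G.Dart, 𝒟.label f = some O → f.fst = y → f ∈ S := by
      intro x y w
      induction w with
      | nil => exact id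
      | @cons x z y h w ih =>
        intro hx
        refine ih fun f hf hfz => ?_
        have hxz : O.1.Adj x z := h
        let g : G.Dart := ⟨(x.1, z.1), hxz.adj_sub⟩
        have hg : 𝒟.label g = some O := (hlab g O).2 hxz
        refine hfib S hS (𝒟.rev g) f ((𝒟.label_rev g).trans hg) hf ?_ (hS.1 _ (hx g hg rfl))
        rw [hrev, hfz]
        rfl
    obtain ⟨w⟩ := (hcyc O O.2).1.coe.preconnected ⟨_, hvert d hd⟩ ⟨_, hvert e he⟩
    exact hwalk _ _ w (fun f hf hfd => hfib S hS d f hd hf hfd hdS) e he rfl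
  exact fun S hS => ⟨main S hS d e hd he, main S hS e d he hd⟩

open Classical in
/-- A cycle of the family has at least three transitions. -/
lemma three_le_card_transitions {𝒪 : Set G.Subgraph} (hcyc : ∀ O ∈ 𝒪, IsCycleSG O)
    {𝒟 : DartSystem G.Dart V 𝒪} (hbase : ∀ d, 𝒟.base d = d.fst)
    (hlab : ∀ d O, 𝒟.label d = some O ↔ d.edge ∈ O.1.edgeSet) (O : 𝒪) :
    3 ≤ (Finset.univ.filter fun a : 𝒟.H => 𝒟.label a = some O).card := by
  obtain ⟨v, hv⟩ := (hcyc O O.2).1.nonempty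
  obtain ⟨x, y, hxy, hN⟩ := Set.ncard_eq_two.1 ((hcyc O O.2).2 v hv)
  have hx : O.1.Adj v x := by
    rw [← Subgraph.mem_neighborSet, hN]
    simp
  have hy : O.1.Adj v y := by
    rw [← Subgraph.mem_neighborSet, hN]
    simp
  have key : ∀ u w, O.1.Adj u w → ∃ a : 𝒟.H, 𝒟.base a = u ∧ 𝒟.label a = some O := by
    intro u w h
    obtain ⟨a, h1, h2, -⟩ := DartSystem.exists_transition (𝒟 := 𝒟) ⟨(u, w), h.adj_sub⟩
    exact ⟨a, by rw [h1, hbase], by rw [h2]; exact (hlab _ _).2 h⟩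
  obtain ⟨a, ha, ha'⟩ := key v x hx
  obtain ⟨b, hb, hb'⟩ := key x v hx.symm
  obtain ⟨c, hc, hc'⟩ := key y v hy.symm
  refine Finset.two_lt_card.2 ⟨a, by simpa using ha', b, by simpa using hb', c,
    by simpa using hc', ?_, ?_, ?_⟩
  · rintro rfl
    exact hx.ne (ha.symm.trans hb)
  · rintro rfl
    exact hy.ne (ha.symm.trans hc)
  · rintro rfl
    exact hxy (hb.symm.trans hc)

/-- In a 2-connected graph, some edge leaves `A` from a vertex other than `v`. -/
lemma TwoConnected.exists_dart (hconn : TwoConnected G) (v : V) (A : Set V)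
    (hA : ∃ a ∈ A, a ≠ v) (hA' : ∃ w ∉ A, w ≠ v) :
    ∃ d : G.Dart, d.fst ∈ A ∧ d.fst ≠ v ∧ d.snd ∉ A := by
  obtain ⟨a, ha, hav⟩ := hA
  obtain ⟨w, hw, hwv⟩ := hA'
  obtain ⟨q⟩ := (hconn.2.2 v).preconnected ⟨a, hav⟩ ⟨w, hwv⟩
  obtain ⟨d, -, h1, h2⟩ := q.exists_boundary_dart {x | x.1 ∈ A} ha hw
  exact ⟨⟨(d.fst.1, d.snd.1), d.adj⟩, h1, d.fst.2, h2⟩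

end Graphs

/-- In a 2-connected 2t-regular graph (`t` even, `t ≥ 2`), for any set of pairwise
edge-disjoint odd cycles there is a `t`-factor `F` that meets every cycle of the set
both in an edge of `F` and in an edge outside `F`. -/
theorem stmt_2 {V : Type*} [Fintype V] (t : ℕ) (ht : 2 ≤ t) (hte : Even t)
    (G : SimpleGraph V)
    (hconn : TwoConnected G) (hreg : IsRegular G (2 * t))
    (𝒪 : Set G.Subgraph) (hodd : ∀ O ∈ 𝒪, IsOddCycleSG O)
    (hdisj : PairwiseEdgeDisjoint 𝒪) :
    ∃ F : G.Subgraph, IsTFactor F t ∧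
      ∀ O ∈ 𝒪, (O.edgeSet ∩ F.edgeSet).Nonempty ∧
        (O.edgeSet ∩ (G.edgeSet \ F.edgeSet)).Nonempty := by
  classical
  have hcyc : ∀ O ∈ 𝒪, IsCycleSG O := fun O hO => (hodd O hO).1
  obtain ⟨𝒟, hbase, hrev, hlab⟩ := exists_dartSystem (even_two_mul t) hreg 𝒪 hcyc hdisj
  have hlink := linked_of_label_eq hcyc hbase hrev hlab
  obtain ⟨M, hM⟩ := DartSystem.exists_isPerfectMatching (𝒟 := 𝒟) hlink
    (fun v => by
      simp only [hbase, card_darts_of_isRegular hreg]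
      obtain ⟨k, rfl⟩ := hte
      exact ⟨k, by ring⟩)
    (fun v A h h' => by
      simpa only [hbase, hrev, Dart.symm_toProd, Prod.fst_swap] using hconn.exists_dart v A h h')
    (fun O => by convert three_le_card_transitions hcyc hbase hlab O)
  obtain ⟨c, p', hp', hβ, hc, hcp, hO⟩ :=
    𝒟.exists_coloring_of_isPerfectMatching hlink M hM
  simp only [hbase] at hβ
  simp only [hrev] at hc
  have hZ : ∀ x : ZMod 2, x + 1 = 1 ↔ ¬ x = 1 := by decide
  refine ⟨colorSubgraph c hc, ⟨fun _ => Set.mem_univ _, fun v => ?_⟩, fun O hOm => ?_⟩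
  · have h := card_eq_two_mul_transversal (Finset.univ.filter fun d : G.Dart => d.fst = v) p' hp'
      (by simp [hβ]) {d | c d = 1} (fun d => by
        simp only [Set.mem_ofPred_eq, hcp]
        exact hZ _)
    rw [card_darts_of_isRegular hreg, Finset.filter_filter] at h
    rw [← card_darts]
    simp only [edge_mem_colorSubgraph]
    simp only [Set.mem_ofPred_eq] at h
    omega
  · obtain ⟨d, hd, hdc⟩ := hO ⟨O, hOm⟩
    have h1 : d.edge ∈ O.edgeSet := (hlab _ _).1 hd
    have h2 : (𝒟.p d).edge ∈ O.edgeSet := (hlab _ _).1 ((𝒟.label_p d).trans hd)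
    have h3 : c (𝒟.p d) = 1 ↔ ¬ c d = 1 := by rw [hdc, hZ]
    by_cases h : c d = 1
    · exact ⟨⟨_, h1, (edge_mem_colorSubgraph _).2 h⟩,
        ⟨_, h2, Dart.edge_mem _, fun h' => h3.1 ((edge_mem_colorSubgraph _).1 h') h⟩⟩
    · exact ⟨⟨_, h2, (edge_mem_colorSubgraph _).2 (h3.2 h)⟩,
        ⟨_, h1, Dart.edge_mem _, fun h' => h ((edge_mem_colorSubgraph _).1 h')⟩⟩

end PaperFormalization
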